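/- Let X(t) be a right-continuous weak Feller Markov process, α > 0, f, G, H continuous bounded, and w(s,x) = sup_τ J(s,x,τ) with J(s,x,τ) = E^x[∫_0^{τ∧τ_O} e^{-αu} f(s+u,X(u)) du + 1_{τ<τ_O} e^{-ατ} G(s+τ,X(τ)) + 1_{τ≥τ_O} e^{-ατ_O} H(s+τ_O,X(τ_O))]. Then s ↦ w(s,x) is continuous, uniformly in x from compact subsets of E. -/

import Mathlib

open MeasureTheory Set Filter Topology ENNReal

noncomputable section

/-- A (Markov) process: a family of laws `P x` on a path space `Ω` together with
the coordinate process `X`. -/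
structure MarkovProcess (E : Type) [MeasurableSpace E]
    (Ω : Type) [MeasurableSpace Ω] where
  P : E → Measure Ω
  isProb : ∀ x, IsProbabilityMeasure (P x)
  X : ℝ → Ω → E
  meas_X : ∀ t : ℝ, Measurable (X t)
  start : ∀ x : E, ∀ᵐ ω ∂ P x, X 0 ω = x

namespace MarkovProcess

variable {E : Type} [MeasurableSpace E] {Ω : Type} [MeasurableSpace Ω]

/-- First exit time from `O` (with value `∞` if the process never leaves `O`). -/
def exitTime (M : MarkovProcess E Ω) (O : Set E) (ω : Ω) : ℝ≥0∞ :=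
  sInf ((fun u : ℝ => ENNReal.ofReal u) '' {u : ℝ | 0 ≤ u ∧ M.X u ω ∉ O})

/-- The natural filtration of the process. -/
def natFiltration (M : MarkovProcess E Ω) : Filtration ℝ (inferInstance : MeasurableSpace Ω) where
  seq t := ⨆ s ∈ Set.Iic t, MeasurableSpace.comap (M.X s) inferInstance
  mono' := by
    intro i j hij
    exact iSup₂_le fun s hs => le_iSup₂_of_le s (hs.trans hij) le_rfl
  le' := by
    intro t
    exact iSup₂_le fun s _ => (M.meas_X s).comap_le

/-- Stopping times (with values in `ℝ≥0∞`) w.r.t. the natural filtration. -/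
def IsStopTime (M : MarkovProcess E Ω) (τ : Ω → ℝ≥0∞) : Prop :=
  ∀ t : ℝ, MeasurableSet[M.natFiltration t] {ω | τ ω ≤ ENNReal.ofReal t}

/-- `∫_0^T e^{-α u} g(s+u, X(u)) du` along the path `ω` (`T` may be `∞`). -/
def runIntegral (M : MarkovProcess E Ω) (α : ℝ) (g : ℝ → E → ℝ) (s : ℝ)
    (T : ℝ≥0∞) (ω : Ω) : ℝ :=
  ∫ u in {u : ℝ | 0 ≤ u ∧ ENNReal.ofReal u < T}, Real.exp (-α * u) * g (s + u) (M.X u ω)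

/-- Discounted payoff `e^{-α T} h(s+T, X(T))`, read as `0` when `T = ∞`. -/
def payoffAt (M : MarkovProcess E Ω) (α : ℝ) (h : ℝ → E → ℝ) (s : ℝ)
    (T : ℝ≥0∞) (ω : Ω) : ℝ :=
  if T ≠ ∞ then Real.exp (-α * T.toReal) * h (s + T.toReal) (M.X T.toReal ω) else 0

/-- The payoff functional
`J(s,x,τ) = E^x[∫_0^{τ∧τ_O} e^{-αu} f(s+u,X(u)) du + 1_{τ<τ_O} e^{-ατ} G(s+τ,X(τ))
  + 1_{τ≥τ_O} e^{-ατ_O} H(s+τ_O,X(τ_O))]`. -/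
def J (M : MarkovProcess E Ω) (O : Set E) (α : ℝ) (f G H : ℝ → E → ℝ)
    (s : ℝ) (x : E) (τ : Ω → ℝ≥0∞) : ℝ :=
  ∫ ω,
    (M.runIntegral α f s (min (τ ω) (M.exitTime O ω)) ω
      + Set.indicator {ω | τ ω < M.exitTime O ω}
          (fun ω => M.payoffAt α G s (τ ω) ω) ω
      + Set.indicator {ω | M.exitTime O ω ≤ τ ω}
          (fun ω => M.payoffAt α H s (M.exitTime O ω) ω) ω) ∂ M.P x

/-- The value function `w(s,x) = sup_τ J(s,x,τ)`, supremum over all stopping times. -/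
def value (M : MarkovProcess E Ω) (O : Set E) (α : ℝ) (f G H : ℝ → E → ℝ)
    (s : ℝ) (x : E) : ℝ :=
  ⨆ τ : {τ : Ω → ℝ≥0∞ // M.IsStopTime τ}, M.J O α f G H s x τ.1

/-- The penalized equation (for `s` in `[0,∞)`):
`w(s,x) = E^x[∫_0^{τ_O} e^{-αu}(f + β (G - w)^+)(s+u,X(u))du + e^{-ατ_O} H(s+τ_O,X(τ_O))]`. -/
def PenEq (M : MarkovProcess E Ω) (O : Set E) (α β : ℝ) (f G H : ℝ → E → ℝ)
    (w : ℝ → E → ℝ) : Prop :=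
  ∀ s : ℝ, 0 ≤ s → ∀ x : E,
    w s x = ∫ ω,
      (M.runIntegral α (fun u y => f u y + β * max (G u y - w u y) 0) s
          (M.exitTime O ω) ω
        + M.payoffAt α H s (M.exitTime O ω) ω) ∂ M.P x


/-- `∫_0^T e^{-αu - ∫_0^u b(t)dt} (g(s+u,X(u)) + b(u) z(s+u,X(u))) du` along the path `ω`. -/
def runIntegralB (M : MarkovProcess E Ω) (α : ℝ) (b : ℝ → Ω → ℝ) (g z : ℝ → E → ℝ)
    (s : ℝ) (T : ℝ≥0∞) (ω : Ω) : ℝ :=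
  ∫ u in {u : ℝ | 0 ≤ u ∧ ENNReal.ofReal u < T},
    Real.exp (-α * u - ∫ t in Set.Ioc (0 : ℝ) u, b t ω) *
      (g (s + u) (M.X u ω) + b u ω * z (s + u) (M.X u ω))

/-- Discounted payoff `e^{-αT - ∫_0^T b(t)dt} h(s+T, X(T))`, read as `0` when `T = ∞`. -/
def payoffAtB (M : MarkovProcess E Ω) (α : ℝ) (b : ℝ → Ω → ℝ) (h : ℝ → E → ℝ)
    (s : ℝ) (T : ℝ≥0∞) (ω : Ω) : ℝ :=
  if T ≠ ∞ then
    Real.exp (-α * T.toReal - ∫ t in Set.Ioc (0 : ℝ) T.toReal, b t ω) *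
      h (s + T.toReal) (M.X T.toReal ω)
  else 0

/-- Boundedness (on `[0,∞) × E`) of a payoff function. -/
def Bdd (g : ℝ → E → ℝ) : Prop := ∃ C : ℝ, ∀ s x, 0 ≤ s → |g s x| ≤ C

/-- The (weak, semigroup form of the) Markov property. -/
def IsMarkov (M : MarkovProcess E Ω) : Prop :=
  ∀ h : E → ℝ, Measurable h → (∃ C, ∀ x, |h x| ≤ C) →
    ∀ (x : E) (s t : ℝ), 0 ≤ s → 0 ≤ t →
      ∫ ω, h (M.X (s + t) ω) ∂ M.P x
        = ∫ ω, (∫ ω', h (M.X t ω') ∂ M.P (M.X s ω)) ∂ M.P x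

/-- Assumption (A1): the stopped semigroup `P_t^{τ_O} h(x) = E^x[1_{t<τ_O} h(X(t))]`
maps continuous bounded functions to continuous (bounded) functions. -/
def A1 [TopologicalSpace E] (M : MarkovProcess E Ω) (O : Set E) : Prop :=
  ∀ t : ℝ, 0 < t → ∀ h : E → ℝ, Continuous h → (∃ C, ∀ x, |h x| ≤ C) →
    Continuous fun x =>
      ∫ ω, Set.indicator {ω | ENNReal.ofReal t < M.exitTime O ω}
        (fun ω => h (M.X t ω)) ω ∂ M.P x

/-- The weak Feller property: the semigroup preserves `C₀(E)`. -/
def WeakFeller [TopologicalSpace E] (M : MarkovProcess E Ω) : Prop :=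
  ∀ t : ℝ, 0 ≤ t → ∀ h : E → ℝ, Continuous h → Tendsto h (cocompact E) (𝓝 0) →
    Continuous (fun x => ∫ ω, h (M.X t ω) ∂ M.P x) ∧
      Tendsto (fun x => ∫ ω, h (M.X t ω) ∂ M.P x) (cocompact E) (𝓝 0)

/-- The strong Feller property (A3). -/
def StrongFeller [TopologicalSpace E] (M : MarkovProcess E Ω) : Prop :=
  ∀ t : ℝ, 0 < t → ∀ h : E → ℝ, Measurable h → (∃ C, ∀ x, |h x| ≤ C) →
    Continuous fun x => ∫ ω, h (M.X t ω) ∂ M.P x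


set_option linter.unusedSectionVars false

section Helpers

variable {E : Type} [MeasurableSpace E] [MetricSpace E] [BorelSpace E]
  [SecondCountableTopology E] {Ω : Type} [MeasurableSpace Ω]

lemma aux_joint (M : MarkovProcess E Ω)
    (hpath : ∀ ω : Ω, ∀ t : ℝ, 0 ≤ t →
      ContinuousWithinAt (fun u => M.X u ω) (Set.Ici t) t) :
    Measurable (fun p : ℝ × Ω => M.X (max p.1 0) p.2) := by
  have hq : ∀ u : ℝ, Tendsto (fun n : ℕ => ((⌊((n:ℝ)+1) * u⌋ : ℝ) + 1) / ((n:ℝ)+1)) atTop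
      (𝓝[Set.Ici u] u) := by
    intro u
    rw [tendsto_nhdsWithin_iff]
    have hpos : ∀ n : ℕ, (0:ℝ) < (n:ℝ) + 1 := fun n => by positivity
    have h1 : ∀ n : ℕ, u ≤ ((⌊((n:ℝ)+1) * u⌋ : ℝ) + 1) / ((n:ℝ)+1) := by
      intro n
      rw [le_div_iff₀ (hpos n)]
      have := (Int.lt_floor_add_one (((n:ℝ)+1) * u)).le
      linarith
    have h2 : ∀ n : ℕ, ((⌊((n:ℝ)+1) * u⌋ : ℝ) + 1) / ((n:ℝ)+1) ≤ u + 1 / ((n:ℝ)+1) := by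
      intro n
      rw [div_le_iff₀ (hpos n), add_mul u, one_div, inv_mul_cancel₀ (hpos n).ne']
      have := Int.floor_le (((n:ℝ)+1) * u)
      linarith
    refine ⟨?_, Eventually.of_forall h1⟩
    refine tendsto_of_tendsto_of_tendsto_of_le_of_le tendsto_const_nhds ?_ h1 h2
    simpa using tendsto_const_nhds.add (tendsto_one_div_add_atTop_nhds_zero_nat (𝕜 := ℝ))
  refine measurable_of_tendsto_metrizable (f := fun (n : ℕ) (p : ℝ × Ω) =>
    M.X (max (((⌊((n:ℝ)+1) * p.1⌋ : ℝ) + 1) / ((n:ℝ)+1)) 0) p.2) ?_ ?_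
  · intro n
    have hm : Measurable (fun q : ℤ × Ω =>
        M.X (max (((q.1 : ℝ) + 1) / ((n:ℝ)+1)) 0) q.2) :=
      measurable_from_prod_countable_right fun k =>
        M.meas_X (max (((k : ℝ) + 1) / ((n:ℝ)+1)) 0)
    have hk : Measurable (fun p : ℝ × Ω => (⌊((n:ℝ)+1) * p.1⌋, p.2)) :=
      (Int.measurable_floor.comp (measurable_const.mul measurable_fst)).prodMk measurable_snd
    exact hm.comp hk
  · rw [tendsto_pi_nhds]
    rintro ⟨u, ω⟩
    have hc := hpath ω (max u 0) (le_max_right _ _)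
    refine Tendsto.comp (f := fun n : ℕ => max (((⌊((n:ℝ)+1) * u⌋ : ℝ) + 1) / ((n:ℝ)+1)) 0)
      (g := fun v => M.X v ω) hc ?_
    have hcont : ContinuousWithinAt (fun v : ℝ => max v 0) (Set.Ici u) u := by
      fun_prop
    have := hcont.tendsto_nhdsWithin (t := Set.Ici (max u 0))
      (fun v hv => by
        simp only [Set.mem_Ici] at hv ⊢
        exact max_le_max_right 0 hv)
    exact this.comp (hq u)

lemma aux_X_time (M : MarkovProcess E Ω)
    (hpath : ∀ ω : Ω, ∀ t : ℝ, 0 ≤ t →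
      ContinuousWithinAt (fun u => M.X u ω) (Set.Ici t) t)
    {σ : Ω → ℝ≥0∞} (hσ : Measurable σ) :
    Measurable (fun ω => M.X (σ ω).toReal ω) := by
  have := (aux_joint M hpath).comp (hσ.ennreal_toReal.prodMk measurable_id)
  have heq : (fun ω => M.X (σ ω).toReal ω) =
      (fun p : ℝ × Ω => M.X (max p.1 0) p.2) ∘ (fun ω => ((σ ω).toReal, id ω)) := by
    ext ω
    simp
  rw [heq]
  exact this

lemma aux_exit_attained (M : MarkovProcess E Ω)
    (hpath : ∀ ω : Ω, ∀ t : ℝ, 0 ≤ t →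
      ContinuousWithinAt (fun u => M.X u ω) (Set.Ici t) t)
    (O : Set E) (hO : IsOpen O) (ω : Ω) (h : M.exitTime O ω ≠ ∞) :
    M.X (M.exitTime O ω).toReal ω ∉ O := by
  intro hmem
  set t := (M.exitTime O ω).toReal with ht
  have ht0 : 0 ≤ t := ENNReal.toReal_nonneg
  have hev : ∀ᶠ u in 𝓝[Set.Ici t] t, M.X u ω ∈ O := (hpath ω t ht0) (hO.mem_nhds hmem)
  obtain ⟨v, hv, hsub⟩ := (mem_nhdsGE_iff_exists_Ico_subset).1 hev
  have hle : ENNReal.ofReal v ≤ M.exitTime O ω := by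
    refine le_sInf ?_
    rintro _ ⟨u, ⟨hu0, hu⟩, rfl⟩
    refine ENNReal.ofReal_le_ofReal ?_
    by_contra hlt
    push Not at hlt
    have h1 : M.exitTime O ω ≤ ENNReal.ofReal u := sInf_le ⟨u, ⟨hu0, hu⟩, rfl⟩
    have h2 : t ≤ u := ENNReal.toReal_le_of_le_ofReal hu0 h1
    exact hu (hsub ⟨h2, hlt⟩)
  have : v ≤ t := (ENNReal.ofReal_le_iff_le_toReal h).1 hle
  exact absurd hv (not_lt.2 this)

/-- One step of the approximation of the exit time from below. -/
def auxNext (M : MarkovProcess E Ω) (O : Set E) (σ : Ω → ℝ≥0∞) (ω : Ω) : ℝ≥0∞ :=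
  open Classical in
  if M.X (σ ω).toReal ω ∈ O then
    ⨅ q : ℚ, if σ ω < ENNReal.ofReal (q:ℝ) ∧
        Metric.infDist (M.X (max (q:ℝ) 0) ω) Oᶜ < Metric.infDist (M.X (σ ω).toReal ω) Oᶜ / 2
      then ENNReal.ofReal (q:ℝ) else ∞
  else σ ω

lemma auxNext_meas (M : MarkovProcess E Ω)
    (hpath : ∀ ω : Ω, ∀ t : ℝ, 0 ≤ t →
      ContinuousWithinAt (fun u => M.X u ω) (Set.Ici t) t)
    (O : Set E) (hO : IsOpen O) {σ : Ω → ℝ≥0∞} (hσ : Measurable σ) :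
    Measurable (M.auxNext O σ) := by
  classical
  have hX := aux_X_time M hpath hσ
  unfold auxNext
  refine Measurable.ite (hX hO.measurableSet) ?_ hσ
  refine Measurable.iInf fun q => ?_
  refine Measurable.ite ?_ measurable_const measurable_const
  refine MeasurableSet.inter (s₁ := {ω | σ ω < ENNReal.ofReal (q:ℝ)})
    (measurableSet_lt hσ measurable_const) ?_
  refine measurableSet_lt (f := fun ω => Metric.infDist (M.X (max (q:ℝ) 0) ω) Oᶜ)
    (g := fun ω => Metric.infDist (M.X (σ ω).toReal ω) Oᶜ / 2) ?_ ?_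
  · exact (Metric.continuous_infDist_pt _).measurable.comp (M.meas_X _)
  · exact ((Metric.continuous_infDist_pt _).measurable.comp hX).div_const 2

lemma auxNext_le (M : MarkovProcess E Ω)
    (hpath : ∀ ω : Ω, ∀ t : ℝ, 0 ≤ t →
      ContinuousWithinAt (fun u => M.X u ω) (Set.Ici t) t)
    (O : Set E) (hO : IsOpen O) (hne : Oᶜ.Nonempty) {σ : Ω → ℝ≥0∞} (ω : Ω)
    (hle : σ ω ≤ M.exitTime O ω) :
    M.auxNext O σ ω ≤ M.exitTime O ω := by
  unfold auxNext
  split_ifs with hin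
  swap
  · exact hle
  by_cases htop : M.exitTime O ω = ∞
  · rw [htop]; exact le_top
  have hout := aux_exit_attained M hpath O hO ω htop
  set t := (M.exitTime O ω).toReal with ht
  have ht0 : 0 ≤ t := ENNReal.toReal_nonneg
  have hte : M.exitTime O ω = ENNReal.ofReal t := (ENNReal.ofReal_toReal htop).symm
  have hd : 0 < Metric.infDist (M.X (σ ω).toReal ω) Oᶜ :=
    (hO.isClosed_compl.notMem_iff_infDist_pos hne).1 (by simpa using hin)
  have hd0 : Metric.infDist (M.X t ω) Oᶜ = 0 := Metric.infDist_zero_of_mem hout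
  have hev : ∀ᶠ u in 𝓝[Set.Ici t] t,
      Metric.infDist (M.X u ω) Oᶜ < Metric.infDist (M.X (σ ω).toReal ω) Oᶜ / 2 := by
    have hc : ContinuousWithinAt (fun u => Metric.infDist (M.X u ω) Oᶜ) (Set.Ici t) t :=
      (Metric.continuous_infDist_pt Oᶜ).continuousAt.comp_continuousWithinAt (hpath ω t ht0)
    exact hc.eventually (gt_mem_nhds (by simp only [hd0]; positivity))
  obtain ⟨v, hv, hsub⟩ := (mem_nhdsGE_iff_exists_Ico_subset).1 hev
  rw [hte]
  refine le_of_forall_gt fun b hb => ?_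
  obtain ⟨c, hc0, hc1, hc2⟩ : ∃ c : ℝ, 0 ≤ c ∧ t < c ∧ ENNReal.ofReal c ≤ b := by
    rcases eq_or_ne b ∞ with rfl | hbt
    · exact ⟨t + 1, by linarith, by linarith, le_top⟩
    · exact ⟨b.toReal, ENNReal.toReal_nonneg, (ENNReal.ofReal_lt_iff_lt_toReal ht0 hbt).1 hb,
        by rw [ENNReal.ofReal_toReal hbt]⟩
  obtain ⟨q, hq1, hq2⟩ := exists_rat_btwn (lt_min hv hc1)
  have hq0 : (0:ℝ) < q := ht0.trans_lt hq1
  refine (iInf_le _ q).trans_lt ?_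
  rw [if_pos]
  · exact ((ENNReal.ofReal_lt_ofReal_iff (hq0.trans (hq2.trans_le (min_le_right _ _)))).2
      (hq2.trans_le (min_le_right _ _))).trans_le hc2
  · refine ⟨(hle.trans_eq hte).trans_lt ((ENNReal.ofReal_lt_ofReal_iff hq0).2 hq1), ?_⟩
    rw [max_eq_left hq0.le]
    exact hsub ⟨hq1.le, hq2.trans_le (min_le_left _ _)⟩

lemma auxNext_ge (M : MarkovProcess E Ω) (O : Set E) {σ : Ω → ℝ≥0∞} (ω : Ω) :
    σ ω ≤ M.auxNext O σ ω := by
  unfold auxNext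
  split_ifs with hin
  · refine le_iInf fun q => ?_
    split_ifs with h
    · exact h.1.le
    · exact le_top
  · exact le_rfl

lemma auxNext_gt (M : MarkovProcess E Ω)
    (hpath : ∀ ω : Ω, ∀ t : ℝ, 0 ≤ t →
      ContinuousWithinAt (fun u => M.X u ω) (Set.Ici t) t)
    (O : Set E) (hO : IsOpen O) (hne : Oᶜ.Nonempty) {σ : Ω → ℝ≥0∞} (ω : Ω)
    (htop : σ ω ≠ ∞) (hin : M.X (σ ω).toReal ω ∈ O) :
    σ ω < M.auxNext O σ ω := by
  unfold auxNext
  rw [if_pos hin]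
  set t := (σ ω).toReal with ht
  have ht0 : 0 ≤ t := ENNReal.toReal_nonneg
  have hte : σ ω = ENNReal.ofReal t := (ENNReal.ofReal_toReal htop).symm
  have hd : 0 < Metric.infDist (M.X t ω) Oᶜ :=
    (hO.isClosed_compl.notMem_iff_infDist_pos hne).1 (by simpa using hin)
  have hev : ∀ᶠ u in 𝓝[Set.Ici t] t,
      Metric.infDist (M.X t ω) Oᶜ / 2 < Metric.infDist (M.X u ω) Oᶜ := by
    have hc : ContinuousWithinAt (fun u => Metric.infDist (M.X u ω) Oᶜ) (Set.Ici t) t :=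
      (Metric.continuous_infDist_pt Oᶜ).continuousAt.comp_continuousWithinAt (hpath ω t ht0)
    exact hc.eventually (lt_mem_nhds (by linarith))
  obtain ⟨v, hv, hsub⟩ := (mem_nhdsGE_iff_exists_Ico_subset).1 hev
  have hv' : t < v := hv
  have : σ ω < ENNReal.ofReal v := by
    rw [hte]; exact (ENNReal.ofReal_lt_ofReal_iff (ht0.trans_lt hv')).2 hv'
  refine this.trans_le (le_iInf fun q => ?_)
  split_ifs with h
  · refine ENNReal.ofReal_le_ofReal ?_
    by_contra hlt
    push Not at hlt
    have hq : t < q := by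
      have := h.1
      rw [hte] at this
      exact (ENNReal.ofReal_lt_ofReal_iff_of_nonneg ht0).1 this
    have h2 := h.2
    rw [max_eq_left (ht0.trans hq.le)] at h2
    have h3 := hsub ⟨hq.le, hlt⟩
    simp only [Set.mem_ofPred_eq] at h3
    linarith
  · exact le_top

/-- The exit time is measurable up to null sets. -/
lemma aux_exit_aemeas (M : MarkovProcess E Ω)
    (hpath : ∀ ω : Ω, ∀ t : ℝ, 0 ≤ t →
      ContinuousWithinAt (fun u => M.X u ω) (Set.Ici t) t)
    (O : Set E) (hO : IsOpen O) (P : Measure Ω) [IsFiniteMeasure P] :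
    AEMeasurable (M.exitTime O) P := by
  rcases Set.eq_empty_or_nonempty Oᶜ with hemp | hne
  · have : M.exitTime O = fun _ => ∞ := by
      ext ω
      have : {u : ℝ | 0 ≤ u ∧ M.X u ω ∉ O} = ∅ := by
        rw [Set.compl_empty_iff] at hemp
        simp [hemp]
      simp [exitTime, this]
    rw [this]
    exact aemeasurable_const
  choose g hgm hgle hgint using fun n : ℕ =>
    exists_measurable_le_lintegral_eq P (fun ω => min (M.exitTime O ω) (n : ℝ≥0∞))
  set σ : Ω → ℝ≥0∞ := fun ω => ⨆ n, g n ω with hσ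
  have hσm : Measurable σ := Measurable.iSup hgm
  have hσle : ∀ ω, σ ω ≤ M.exitTime O ω := fun ω =>
    iSup_le fun n => (hgle n ω).trans (min_le_left _ _)
  have hnm := auxNext_meas M hpath O hO hσm
  have hnle : ∀ ω, M.auxNext O σ ω ≤ M.exitTime O ω := fun ω =>
    auxNext_le M hpath O hO hne ω (hσle ω)
  have hae : ∀ n : ℕ, ∀ᵐ ω ∂P, min (σ ω) (n : ℝ≥0∞) = min (M.auxNext O σ ω) (n : ℝ≥0∞) := by
    intro n
    refine ae_eq_of_ae_le_of_lintegral_le (Eventually.of_forall fun ω =>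
      min_le_min_right _ (auxNext_ge M O ω)) ?_ (hnm.min measurable_const).aemeasurable ?_
    · refine ne_top_of_le_ne_top (b := ∫⁻ _, (n : ℝ≥0∞) ∂P) ?_
        (lintegral_mono fun ω => min_le_right _ _)
      rw [lintegral_const]
      exact ENNReal.mul_ne_top (by simp) (measure_ne_top _ _)
    · calc ∫⁻ ω, min (M.auxNext O σ ω) (n : ℝ≥0∞) ∂P
          ≤ ∫⁻ ω, min (M.exitTime O ω) (n : ℝ≥0∞) ∂P :=
            lintegral_mono fun ω => min_le_min_right _ (hnle ω)
        _ = ∫⁻ ω, g n ω ∂P := hgint n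
        _ ≤ _ := lintegral_mono fun ω =>
            le_min (le_iSup (fun n => g n ω) n) ((hgle n ω).trans (min_le_right _ _))
  refine ⟨σ, hσm, ?_⟩
  filter_upwards [ae_all_iff.2 hae] with ω hω
  refine le_antisymm ?_ (hσle ω)
  by_cases htop : σ ω = ∞
  · rw [htop]; exact le_top
  have hnin : M.X (σ ω).toReal ω ∉ O := by
    intro hin
    have hlt := auxNext_gt M hpath O hO hne ω htop hin
    obtain ⟨n, hn⟩ := ENNReal.exists_nat_gt htop
    have h1 := hω n
    rw [min_eq_left hn.le] at h1
    exact absurd h1 (lt_min hlt hn).ne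
  calc M.exitTime O ω ≤ ENNReal.ofReal (σ ω).toReal :=
        sInf_le ⟨_, ⟨ENNReal.toReal_nonneg, hnin⟩, rfl⟩
    _ = σ ω := ENNReal.ofReal_toReal htop

lemma aux_stop_meas (M : MarkovProcess E Ω) {τ : Ω → ℝ≥0∞} (h : M.IsStopTime τ) :
    Measurable τ := by
  refine measurable_of_Iic fun a => ?_
  rcases eq_or_ne a ∞ with rfl | ha
  · simp
  · have := M.natFiltration.le _ _ (h a.toReal)
    rw [ENNReal.ofReal_toReal ha] at this
    exact this

end Helpers
section Helpers2

variable {E : Type} [MeasurableSpace E] [MetricSpace E] [BorelSpace E]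
  [SecondCountableTopology E] {Ω : Type} [MeasurableSpace Ω]

/-- The integrand of `J`. -/
def auxF (M : MarkovProcess E Ω) (α : ℝ) (f G H : ℝ → E → ℝ)
    (s : ℝ) (a b : ℝ≥0∞) (ω : Ω) : ℝ :=
  M.runIntegral α f s (min a b) ω + (if a < b then M.payoffAt α G s a ω else 0)
    + (if b ≤ a then M.payoffAt α H s b ω else 0)

lemma aux_J (M : MarkovProcess E Ω) (O : Set E) (α : ℝ) (f G H : ℝ → E → ℝ)
    (s : ℝ) (x : E) (τ : Ω → ℝ≥0∞) :
    M.J O α f G H s x τ = ∫ ω, M.auxF α f G H s (τ ω) (M.exitTime O ω) ω ∂ M.P x := by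
  simp only [J, auxF, Set.indicator_apply, Set.mem_ofPred_eq]

lemma aux_run_meas (M : MarkovProcess E Ω)
    (hpath : ∀ ω : Ω, ∀ t : ℝ, 0 ≤ t →
      ContinuousWithinAt (fun u => M.X u ω) (Set.Ici t) t)
    (α : ℝ) {f : ℝ → E → ℝ} (hf : Continuous (Function.uncurry f)) (s : ℝ)
    {T : Ω → ℝ≥0∞} (hT : Measurable T) :
    Measurable (fun ω => M.runIntegral α f s (T ω) ω) := by
  have hj : Measurable (fun p : Ω × ℝ => M.X (max p.2 0) p.1) :=
    (aux_joint M hpath).comp measurable_swap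
  have hg : Measurable (fun p : Ω × ℝ =>
      Real.exp (-α * p.2) * f (s + p.2) (M.X (max p.2 0) p.1)) := by
    refine Measurable.mul (by fun_prop) ?_
    exact hf.measurable.comp
      (f := fun p : Ω × ℝ => (s + p.2, M.X (max p.2 0) p.1))
      ((measurable_const.add measurable_snd).prodMk hj)
  have hS : MeasurableSet {p : Ω × ℝ | 0 ≤ p.2 ∧ ENNReal.ofReal p.2 < T p.1} := by
    refine MeasurableSet.inter (s₁ := {p : Ω × ℝ | 0 ≤ p.2})
      (s₂ := {p : Ω × ℝ | ENNReal.ofReal p.2 < T p.1})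
      (measurableSet_le measurable_const measurable_snd) ?_
    exact measurableSet_lt (measurable_snd.ennreal_ofReal) (hT.comp measurable_fst)
  have hm := ((hg.indicator hS).stronglyMeasurable.integral_prod_right' (ν := volume)).measurable
  convert hm using 2 with ω
  unfold runIntegral
  rw [← integral_indicator]
  · congr 1
    ext u
    by_cases hu : 0 ≤ u ∧ ENNReal.ofReal u < T ω
    · simp [Set.indicator_apply, hu]
    · simp [Set.indicator_apply, hu]
  · exact measurable_prodMk_left (x := ω) hS

lemma aux_pay_meas (M : MarkovProcess E Ω)
    (hpath : ∀ ω : Ω, ∀ t : ℝ, 0 ≤ t →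
      ContinuousWithinAt (fun u => M.X u ω) (Set.Ici t) t)
    (α : ℝ) {f : ℝ → E → ℝ} (hf : Continuous (Function.uncurry f)) (s : ℝ)
    {T : Ω → ℝ≥0∞} (hT : Measurable T) :
    Measurable (fun ω => M.payoffAt α f s (T ω) ω) := by
  unfold payoffAt
  refine Measurable.ite ?_ ?_ measurable_const
  · exact (hT (measurableSet_singleton ∞)).compl
  · refine Measurable.mul (by fun_prop) ?_
    exact hf.measurable.comp
      (f := fun ω => (s + (T ω).toReal, M.X (T ω).toReal ω))
      ((measurable_const.add hT.ennreal_toReal).prodMk (aux_X_time M hpath hT))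

lemma auxF_aemeas (M : MarkovProcess E Ω)
    (hpath : ∀ ω : Ω, ∀ t : ℝ, 0 ≤ t →
      ContinuousWithinAt (fun u => M.X u ω) (Set.Ici t) t)
    (O : Set E) (hO : IsOpen O) (P : Measure Ω) [IsFiniteMeasure P]
    (α : ℝ) {f G H : ℝ → E → ℝ} (hfc : Continuous (Function.uncurry f))
    (hGc : Continuous (Function.uncurry G))
    (hHc : Continuous (Function.uncurry H)) (s : ℝ) {τ : Ω → ℝ≥0∞} (hτ : Measurable τ) :
    AEStronglyMeasurable (fun ω => M.auxF α f G H s (τ ω) (M.exitTime O ω) ω) P := by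
  obtain ⟨σ, hσ, hae⟩ := aux_exit_aemeas M hpath O hO P
  refine AEMeasurable.aestronglyMeasurable
    ⟨fun ω => M.auxF α f G H s (τ ω) (σ ω) ω, ?_, ?_⟩
  · unfold auxF
    refine ((aux_run_meas M hpath α hfc s (hτ.min hσ)).add ?_).add ?_
    · exact Measurable.ite (measurableSet_lt hτ hσ) (aux_pay_meas M hpath α hGc s hτ)
        measurable_const
    · exact Measurable.ite (measurableSet_le hσ hτ) (aux_pay_meas M hpath α hHc s hσ)
        measurable_const
  · filter_upwards [hae] with ω hω
    rw [hω]

lemma aux_exp_int {β : ℝ} (hβ : 0 < β) :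
    IntegrableOn (fun u : ℝ => Real.exp (-β * u)) (Set.Ici 0) ∧
      ∫ u in Set.Ici (0:ℝ), Real.exp (-β * u) = 1 / β := by
  constructor
  · rw [integrableOn_Ici_iff_integrableOn_Ioi]
    exact integrableOn_exp_mul_Ioi (by linarith) 0
  · rw [integral_Ici_eq_integral_Ioi, integral_exp_mul_Ioi (by linarith)]
    simp

lemma aux_set_meas (T : ℝ≥0∞) : MeasurableSet {u : ℝ | 0 ≤ u ∧ ENNReal.ofReal u < T} := by
  refine MeasurableSet.inter (s₁ := {u : ℝ | 0 ≤ u})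
      (s₂ := {u : ℝ | ENNReal.ofReal u < T})
      (measurableSet_le measurable_const measurable_id) ?_
  exact measurableSet_lt (measurable_id.ennreal_ofReal) measurable_const

lemma aux_int_bound {β η : ℝ} (hβ : 0 < β) (hη : 0 ≤ η) (T : ℝ≥0∞) {a : ℝ → ℝ}
    (hb : ∀ u, 0 ≤ u → |a u| ≤ η * Real.exp (-β * u)) :
    |∫ u in {u : ℝ | 0 ≤ u ∧ ENNReal.ofReal u < T}, a u| ≤ η / β := by
  have hi := (aux_exp_int hβ).1.const_mul η
  have hsub : {u : ℝ | 0 ≤ u ∧ ENNReal.ofReal u < T} ⊆ Set.Ici 0 := fun u hu => hu.1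
  calc |∫ u in {u : ℝ | 0 ≤ u ∧ ENNReal.ofReal u < T}, a u|
      ≤ ∫ u in {u : ℝ | 0 ≤ u ∧ ENNReal.ofReal u < T}, η * Real.exp (-β * u) := by
        rw [← Real.norm_eq_abs]
        refine norm_integral_le_of_norm_le (IntegrableOn.mono_set hi hsub) ?_
        filter_upwards [ae_restrict_mem (aux_set_meas T)] with u hu
        exact hb u hu.1
    _ ≤ ∫ u in Set.Ici (0:ℝ), η * Real.exp (-β * u) := by
        refine setIntegral_mono_set hi (Eventually.of_forall fun u => ?_)
          (Eventually.of_forall hsub)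
        simp only [Pi.zero_apply]
        positivity
    _ = η / β := by rw [integral_const_mul, (aux_exp_int hβ).2]; ring

lemma auxF_bound (M : MarkovProcess E Ω) {α : ℝ} (hα : 0 < α) {f G H : ℝ → E → ℝ}
    {s C : ℝ} (hC : 0 ≤ C) (hs : 0 ≤ s)
    (hf : ∀ s x, 0 ≤ s → |f s x| ≤ C) (hG : ∀ s x, 0 ≤ s → |G s x| ≤ C)
    (hH : ∀ s x, 0 ≤ s → |H s x| ≤ C) (a b : ℝ≥0∞) (ω : Ω) :
    |M.auxF α f G H s a b ω| ≤ C / α + C := by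
  have key : ∀ g : ℝ → E → ℝ, (∀ s x, 0 ≤ s → |g s x| ≤ C) → ∀ u, 0 ≤ u →
      |Real.exp (-α * u) * g (s + u) (M.X u ω)| ≤ C * Real.exp (-α * u) := by
    intro g hg u hu
    rw [abs_mul, abs_of_pos (Real.exp_pos _), mul_comm]
    exact mul_le_mul_of_nonneg_right (hg _ _ (by linarith)) (Real.exp_pos _).le
  have keyp : ∀ g : ℝ → E → ℝ, (∀ s x, 0 ≤ s → |g s x| ≤ C) → ∀ T,
      |M.payoffAt α g s T ω| ≤ C := by
    intro g hg T
    unfold payoffAt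
    split_ifs
    · refine (key g hg _ ENNReal.toReal_nonneg).trans (mul_le_of_le_one_right hC ?_)
      refine Real.exp_le_one_iff.2 ?_
      have : 0 ≤ T.toReal := ENNReal.toReal_nonneg
      nlinarith
    · simpa using hC
  have h1 : |M.runIntegral α f s (min a b) ω| ≤ C / α :=
    aux_int_bound hα hC _ (key f hf)
  unfold auxF
  rcases lt_or_ge a b with hab | hab
  · rw [if_pos hab, if_neg (not_le.2 hab), add_zero]
    exact (abs_add_le _ _).trans (add_le_add h1 (keyp G hG _))
  · rw [if_neg (not_lt.2 hab), if_pos hab, add_zero]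
    exact (abs_add_le _ _).trans (add_le_add h1 (keyp H hH _))

lemma auxF_diff (M : MarkovProcess E Ω)
    (hpath : ∀ ω : Ω, ∀ t : ℝ, 0 ≤ t →
      ContinuousWithinAt (fun u => M.X u ω) (Set.Ici t) t)
    {α : ℝ} (hα : 0 < α) {f G H : ℝ → E → ℝ}
    (hfc : Continuous (Function.uncurry f))
    {s s' C η : ℝ} (hs : 0 ≤ s) (hs' : 0 ≤ s') (hη : 0 ≤ η) (hC : 0 ≤ C)
    (hfb : ∀ s x, 0 ≤ s → |f s x| ≤ C) (ω : Ω)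
    (hd : ∀ g ∈ ({f, G, H} : Set (ℝ → E → ℝ)), ∀ u, 0 ≤ u →
      Real.exp (-α * u) * |g (s + u) (M.X u ω) - g (s' + u) (M.X u ω)|
        ≤ η * Real.exp (-(α / 2) * u))
    (a b : ℝ≥0∞) :
    |M.auxF α f G H s a b ω - M.auxF α f G H s' a b ω| ≤ η / (α / 2) + η := by
  have keyp : ∀ g ∈ ({f, G, H} : Set (ℝ → E → ℝ)), ∀ T,
      |M.payoffAt α g s T ω - M.payoffAt α g s' T ω| ≤ η := by
    intro g hg T
    unfold payoffAt
    split_ifs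
    · rw [← mul_sub, abs_mul, abs_of_pos (Real.exp_pos _)]
      refine (hd g hg _ ENNReal.toReal_nonneg).trans (mul_le_of_le_one_right hη ?_)
      refine Real.exp_le_one_iff.2 ?_
      have : 0 ≤ T.toReal := ENNReal.toReal_nonneg
      nlinarith
    · simpa using hη
  have hint : ∀ r, 0 ≤ r → IntegrableOn
      (fun u => Real.exp (-α * u) * f (r + u) (M.X u ω))
      {u : ℝ | 0 ≤ u ∧ ENNReal.ofReal u < min a b} := by
    intro r hr
    have hi : IntegrableOn (fun u : ℝ => C * Real.exp (-α * u))
        {u : ℝ | 0 ≤ u ∧ ENNReal.ofReal u < min a b} :=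
      IntegrableOn.mono_set ((aux_exp_int hα).1.const_mul C) (fun u hu => hu.1)
    have hXm : Measurable (fun u : ℝ => M.X (max u 0) ω) :=
      (aux_joint M hpath).comp (measurable_id.prodMk measurable_const)
    have hm : Measurable (fun u => Real.exp (-α * u) * f (r + u) (M.X (max u 0) ω)) := by
      refine Measurable.mul (by fun_prop) ?_
      exact hfc.measurable.comp (f := fun u : ℝ => (r + u, M.X (max u 0) ω))
        ((measurable_const.add measurable_id).prodMk hXm)
    refine Integrable.mono' hi (hm.aestronglyMeasurable.congr ?_) ?_
    · filter_upwards [ae_restrict_mem (aux_set_meas (min a b))] with u hu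
      rw [max_eq_left hu.1]
    · filter_upwards [ae_restrict_mem (aux_set_meas (min a b))] with u hu
      rw [Real.norm_eq_abs, abs_mul, abs_of_pos (Real.exp_pos _), mul_comm]
      exact mul_le_mul_of_nonneg_right (hfb _ _ (by linarith [hu.1])) (Real.exp_pos _).le
  have h1 : |M.runIntegral α f s (min a b) ω - M.runIntegral α f s' (min a b) ω|
      ≤ η / (α / 2) := by
    unfold runIntegral
    rw [← integral_sub (hint s hs) (hint s' hs')]
    refine aux_int_bound (by positivity) hη _ fun u hu => ?_
    rw [← mul_sub, abs_mul, abs_of_pos (Real.exp_pos _)]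
    exact hd f (by simp) u hu
  unfold auxF
  rcases lt_or_ge a b with hab | hab
  · simp only [if_pos hab, if_neg (not_le.2 hab), add_zero]
    rw [add_sub_add_comm]
    exact (abs_add_le _ _).trans (add_le_add h1 (keyp G (by simp) _))
  · simp only [if_neg (not_lt.2 hab), if_pos hab, add_zero]
    rw [add_sub_add_comm]
    exact (abs_add_le _ _).trans (add_le_add h1 (keyp H (by simp) _))

lemma aux_unif {g : ℝ → E → ℝ} (hg : Continuous (Function.uncurry g)) {L : Set E}
    (hL : IsCompact L) (T s₀ : ℝ) {δ : ℝ} (hδ : 0 < δ) :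
    ∀ᶠ s in 𝓝 s₀, ∀ p ∈ Set.Icc (0:ℝ) T ×ˢ L,
      |g (s + p.1) p.2 - g (s₀ + p.1) p.2| < δ := by
  refine (isCompact_Icc.prod hL).eventually_forall_of_forall_eventually fun p _ => ?_
  have hc : Continuous (fun z : ℝ × (ℝ × E) =>
      |g (z.1 + z.2.1) z.2.2 - g (s₀ + z.2.1) z.2.2|) := by
    have h1 : Continuous (fun z : ℝ × (ℝ × E) => g (z.1 + z.2.1) z.2.2) :=
      hg.comp (f := fun z : ℝ × (ℝ × E) => (z.1 + z.2.1, z.2.2)) (by fun_prop)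
    have h2 : Continuous (fun z : ℝ × (ℝ × E) => g (s₀ + z.2.1) z.2.2) :=
      hg.comp (f := fun z : ℝ × (ℝ × E) => (s₀ + z.2.1, z.2.2)) (by fun_prop)
    exact (h1.sub h2).abs
  exact hc.continuousAt.eventually (gt_mem_nhds (by simpa using hδ))

lemma aux_value (M : MarkovProcess E Ω) (O : Set E) (α : ℝ) (f G H : ℝ → E → ℝ)
    (s s' : ℝ) (x : E) (B ε : ℝ)
    (hB : ∀ τ, M.IsStopTime τ → |M.J O α f G H s x τ| ≤ B)
    (hB' : ∀ τ, M.IsStopTime τ → |M.J O α f G H s' x τ| ≤ B)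
    (hd : ∀ τ, M.IsStopTime τ → |M.J O α f G H s x τ - M.J O α f G H s' x τ| ≤ ε) :
    |M.value O α f G H s x - M.value O α f G H s' x| ≤ ε := by
  have : Nonempty {τ : Ω → ℝ≥0∞ // M.IsStopTime τ} := by
    refine ⟨⟨fun _ => ∞, fun t => ?_⟩⟩
    simp
  have hbd : ∀ r, (∀ τ, M.IsStopTime τ → |M.J O α f G H r x τ| ≤ B) →
      BddAbove (Set.range fun τ : {τ : Ω → ℝ≥0∞ // M.IsStopTime τ} =>
        M.J O α f G H r x τ.1) := by
    rintro r hr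
    refine ⟨B, ?_⟩
    rintro _ ⟨τ, rfl⟩
    exact (abs_le.1 (hr τ.1 τ.2)).2
  rw [abs_sub_le_iff]
  unfold value
  constructor
  · rw [sub_le_iff_le_add]
    refine ciSup_le fun τ => ?_
    have h1 := le_ciSup (hbd s' hB') τ
    have h2 := (abs_le.1 (hd τ.1 τ.2)).2
    linarith
  · rw [sub_le_iff_le_add]
    refine ciSup_le fun τ => ?_
    have h1 := le_ciSup (hbd s hB) τ
    have h2 := (abs_le.1 (hd τ.1 τ.2)).1
    linarith

end Helpers2

/-- for a right-continuous weak Feller process, `s ↦ w(s,x)` is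
continuous uniformly in `x` from compact subsets of `E`. -/
theorem stmt19 {E : Type} [MeasurableSpace E] [MetricSpace E] [BorelSpace E]
    [ProperSpace E] [SecondCountableTopology E]
    {Ω : Type} [MeasurableSpace Ω] (M : MarkovProcess E Ω)
    (hM : M.IsMarkov) (hFeller : M.WeakFeller)
    (hpath : ∀ ω : Ω, ∀ t : ℝ, 0 ≤ t →
      ContinuousWithinAt (fun u => M.X u ω) (Set.Ici t) t)
    (hCC : ∀ K : Set E, IsCompact K → ∀ T : ℝ, 0 < T → ∀ ε : ℝ, 0 < ε →
      ∃ L : Set E, IsCompact L ∧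
        ∀ x ∈ K, (M.P x {ω | ∃ t ∈ Set.Icc (0 : ℝ) T, M.X t ω ∉ L}).toReal ≤ ε)
    (O : Set E) (hO : IsOpen O) (α : ℝ) (hα : 0 < α) (f G H : ℝ → E → ℝ)
    (hfc : Continuous (Function.uncurry f)) (hGc : Continuous (Function.uncurry G))
    (hHc : Continuous (Function.uncurry H))
    (hfb : Bdd f) (hGb : Bdd G) (hHb : Bdd H) :
    ∀ K : Set E, IsCompact K → ∀ s₀ : ℝ, 0 ≤ s₀ →
      TendstoUniformlyOn (fun s x => M.value O α f G H s x)
        (fun x => M.value O α f G H s₀ x) (𝓝[Set.Ici 0] s₀) K := by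
  classical
  intro K hK s₀ hs₀
  obtain ⟨C₁, hC₁⟩ := hfb
  obtain ⟨C₂, hC₂⟩ := hGb
  obtain ⟨C₃, hC₃⟩ := hHb
  obtain ⟨C, hC, hfC, hGC, hHC⟩ : ∃ C : ℝ, 0 ≤ C ∧ (∀ s x, 0 ≤ s → |f s x| ≤ C) ∧
      (∀ s x, 0 ≤ s → |G s x| ≤ C) ∧ (∀ s x, 0 ≤ s → |H s x| ≤ C) := by
    refine ⟨|C₁| + |C₂| + |C₃|, by positivity, fun s x hs => ?_, fun s x hs => ?_,
      fun s x hs => ?_⟩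
    · linarith [hC₁ s x hs, le_abs_self C₁, abs_nonneg C₂, abs_nonneg C₃]
    · linarith [hC₂ s x hs, le_abs_self C₂, abs_nonneg C₁, abs_nonneg C₃]
    · linarith [hC₃ s x hs, le_abs_self C₃, abs_nonneg C₂, abs_nonneg C₁]
  have hgC : ∀ g ∈ ({f, G, H} : Set (ℝ → E → ℝ)), ∀ s x, 0 ≤ s → |g s x| ≤ C := by
    rintro g (rfl | rfl | rfl)
    exacts [hfC, hGC, hHC]
  rw [Metric.tendstoUniformlyOn_iff]
  intro ε hε
  set B : ℝ := C / α + C with hBdef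
  have hB0 : 0 ≤ B := by positivity
  -- choice of the constants
  set κ : ℝ := 1 / (α / 2) + 1 with hκ
  have hκ0 : 0 < κ := by positivity
  set η : ℝ := ε / (4 * κ) with hη
  have hη0 : 0 < η := by positivity
  obtain ⟨T, hT0, hT⟩ : ∃ T : ℝ, 0 < T ∧ 2 * C * Real.exp (-(α / 2) * T) ≤ η := by
    have hlim : Tendsto (fun T : ℝ => 2 * C * Real.exp (-(α / 2) * T)) atTop (𝓝 (2 * C * 0)) := by
      refine Tendsto.const_mul _ (Real.tendsto_exp_atBot.comp ?_)
      exact tendsto_id.const_mul_atTop_of_neg (by linarith)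
    rw [mul_zero] at hlim
    obtain ⟨T, h1, h2⟩ := ((eventually_gt_atTop 0).and
      (hlim.eventually (gt_mem_nhds hη0))).exists
    exact ⟨T, h1, h2.le⟩
  set ε' : ℝ := ε / (4 * (2 * B + 1)) with hε'
  have hε'0 : 0 < ε' := by positivity
  obtain ⟨L, hL, hLK⟩ := hCC K hK T hT0 ε' hε'0
  filter_upwards [nhdsWithin_le_nhds (aux_unif hfc hL T s₀ hη0),
    nhdsWithin_le_nhds (aux_unif hGc hL T s₀ hη0),
    nhdsWithin_le_nhds (aux_unif hHc hL T s₀ hη0), self_mem_nhdsWithin] with s h1 h2 h3 hs x hx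
  have hs : 0 ≤ s := hs
  have hgu : ∀ g ∈ ({f, G, H} : Set (ℝ → E → ℝ)), ∀ p ∈ Set.Icc (0:ℝ) T ×ˢ L,
      |g (s + p.1) p.2 - g (s₀ + p.1) p.2| < η := by
    rintro g (rfl | rfl | rfl)
    exacts [h1, h2, h3]
  have := M.isProb x
  set A : Set Ω := {ω | ∃ t ∈ Set.Icc (0 : ℝ) T, M.X t ω ∉ L} with hA
  set A' : Set Ω := toMeasurable (M.P x) A with hA'
  have hA'm : MeasurableSet A' := measurableSet_toMeasurable _ _
  have hA'p : (M.P x).real A' ≤ ε' := by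
    rw [Measure.real, hA', measure_toMeasurable]
    exact hLK x hx
  have hFb : ∀ r, 0 ≤ r → ∀ a b ω, |M.auxF α f G H r a b ω| ≤ B := fun r hr a b ω =>
    auxF_bound M hα hC hr hfC hGC hHC a b ω
  have hJb : ∀ r, 0 ≤ r → ∀ τ, M.IsStopTime τ → |M.J O α f G H r x τ| ≤ B := by
    intro r hr τ _
    rw [aux_J]
    have := norm_integral_le_of_norm_le_const (μ := M.P x)
      (f := fun ω => M.auxF α f G H r (τ ω) (M.exitTime O ω) ω) (C := B)
      (Eventually.of_forall fun ω => hFb r hr _ _ ω)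
    simpa using this
  -- pathwise estimate off the bad event
  have hgood : ∀ ω, ω ∉ A' → ∀ a b,
      |M.auxF α f G H s a b ω - M.auxF α f G H s₀ a b ω| ≤ η * κ := by
    intro ω hω a b
    have hωA : ω ∉ A := fun h => hω (subset_toMeasurable _ _ h)
    have hin : ∀ t ∈ Set.Icc (0:ℝ) T, M.X t ω ∈ L := by
      intro t ht
      by_contra hcon
      exact hωA ⟨t, ht, hcon⟩
    refine (auxF_diff M hpath hα hfc hs hs₀ hη0.le hC hfC ω ?_ a b).trans_eq
      (by rw [hκ]; ring)
    intro g hg u hu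
    rcases le_or_gt u T with huT | huT
    · have hlt := hgu g hg (u, M.X u ω) ⟨⟨hu, huT⟩, hin u ⟨hu, huT⟩⟩
      rw [mul_comm]
      refine mul_le_mul hlt.le (Real.exp_le_exp.2 ?_) (Real.exp_pos _).le hη0.le
      nlinarith
    · have hb : |g (s + u) (M.X u ω) - g (s₀ + u) (M.X u ω)| ≤ 2 * C := by
        refine (abs_sub _ _).trans ?_
        linarith [hgC g hg (s + u) (M.X u ω) (by linarith),
          hgC g hg (s₀ + u) (M.X u ω) (by linarith)]
      have he : Real.exp (-α * u) = Real.exp (-(α / 2) * u) * Real.exp (-(α / 2) * u) := by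
        rw [← Real.exp_add]; congr 1; ring
      have he2 : Real.exp (-(α / 2) * u) ≤ Real.exp (-(α / 2) * T) :=
        Real.exp_le_exp.2 (by nlinarith)
      calc Real.exp (-α * u) * |g (s + u) (M.X u ω) - g (s₀ + u) (M.X u ω)|
          ≤ Real.exp (-α * u) * (2 * C) :=
            mul_le_mul_of_nonneg_left hb (Real.exp_pos _).le
        _ = (2 * C * Real.exp (-(α / 2) * u)) * Real.exp (-(α / 2) * u) := by rw [he]; ring
        _ ≤ (2 * C * Real.exp (-(α / 2) * T)) * Real.exp (-(α / 2) * u) := by gcongr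
        _ ≤ η * Real.exp (-(α / 2) * u) := by gcongr
  have hJd : ∀ τ, M.IsStopTime τ →
      |M.J O α f G H s x τ - M.J O α f G H s₀ x τ| ≤ ε / 2 := by
    intro τ hτ
    have hτm := aux_stop_meas M hτ
    have hint : ∀ r, 0 ≤ r →
        Integrable (fun ω => M.auxF α f G H r (τ ω) (M.exitTime O ω) ω) (M.P x) := by
      intro r hr
      exact Integrable.of_bound (auxF_aemeas M hpath O hO (M.P x) α hfc hGc hHc r hτm) B
        (Eventually.of_forall fun ω => hFb r hr _ _ ω)
    rw [aux_J, aux_J, ← integral_sub (hint s hs) (hint s₀ hs₀)]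
    have hbi : Integrable (fun ω => η * κ + A'.indicator (fun _ => 2 * B) ω) (M.P x) :=
      (integrable_const _).add ((integrable_const _).indicator hA'm)
    have hle := norm_integral_le_of_norm_le (μ := M.P x)
      (f := fun ω => M.auxF α f G H s (τ ω) (M.exitTime O ω) ω -
        M.auxF α f G H s₀ (τ ω) (M.exitTime O ω) ω) hbi
      (Eventually.of_forall fun ω => by
        rw [Real.norm_eq_abs]
        by_cases hω : ω ∈ A'
        · rw [Set.indicator_of_mem hω]
          refine (abs_sub _ _).trans ?_
          have : 0 ≤ η * κ := by positivity
          linarith [hFb s hs (τ ω) (M.exitTime O ω) ω, hFb s₀ hs₀ (τ ω) (M.exitTime O ω) ω]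
        · rw [Set.indicator_of_notMem hω, add_zero]
          exact hgood ω hω _ _)
    rw [Real.norm_eq_abs] at hle
    refine hle.trans ?_
    rw [integral_add (integrable_const _) ((integrable_const _).indicator hA'm),
      integral_indicator_const _ hA'm]
    simp only [integral_const, probReal_univ, smul_eq_mul, one_mul]
    have e1 : η * κ = ε / 4 := by rw [hη]; field_simp
    have e2 : (M.P x).real A' * (2 * B) ≤ ε / 4 := by
      calc (M.P x).real A' * (2 * B) ≤ ε' * (2 * B + 1) := by
            apply mul_le_mul hA'p (by linarith) (by positivity) hε'0.le
        _ = ε / 4 := by rw [hε']; field_simp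
    linarith
  rw [dist_comm, Real.dist_eq]
  have := aux_value M O α f G H s s₀ x B (ε / 2) (hJb s hs) (hJb s₀ hs₀) hJd
  linarith

end MarkovProcess
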